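/- Let R be a ring, let C be an n-cotilting right R-module, and let 𝒜 = {M : Ext^i_R(M, C) = 0 for all i ≥ 1} be the associated n-cotilting class. Then every acyclic unbounded cochain complex of right R-modules all of whose components lie in 𝒜 has all of its cycle modules in 𝒜; that is, ex𝒜 = 𝒜~. -/

import Mathlib

open CategoryTheory CategoryTheory.Limits CategoryTheory.Abelian ZeroObject

universe w' w v u

/-- There is a short exact sequence `0 → X → Y → Z → 0` in the abelian category `C`. -/
def IsShortExactSeq {C : Type u} [Category.{v} C] [Abelian C] (X Y Z : C) : Prop :=
  ∃ (f : X ⟶ Y) (g : Y ⟶ Z) (w : f ≫ g = 0), (ShortComplex.mk f g w).ShortExact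

/-- `(𝒜, ℬ)` is a cotorsion pair in the abelian category `C`:
each class is the `Ext¹`-orthogonal of the other. -/
structure IsCotorsionPair (C : Type u) [Category.{v} C] [Abelian C] [HasExt.{w} C]
    (𝒜 ℬ : Set C) : Prop where
  mem_left_iff : ∀ X : C, X ∈ 𝒜 ↔ ∀ B ∈ ℬ, Subsingleton (Abelian.Ext.{w} X B 1)
  mem_right_iff : ∀ Y : C, Y ∈ ℬ ↔ ∀ A ∈ 𝒜, Subsingleton (Abelian.Ext.{w} A Y 1)

/-- `(𝒜, ℬ)` is a complete cotorsion pair: every object has a special `ℬ`-preenvelope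
`0 → M → B → A → 0` and a special `𝒜`-precover `0 → B' → A' → M → 0`. -/
structure IsCompleteCotorsionPair (C : Type u) [Category.{v} C] [Abelian C] [HasExt.{w} C]
    (𝒜 ℬ : Set C) extends IsCotorsionPair C 𝒜 ℬ : Prop where
  preenvelope : ∀ M : C, ∃ B A, B ∈ ℬ ∧ A ∈ 𝒜 ∧ IsShortExactSeq M B A
  precover : ∀ M : C, ∃ B A, B ∈ ℬ ∧ A ∈ 𝒜 ∧ IsShortExactSeq B A M

/-- `(𝒜, ℬ)` is a complete hereditary cotorsion pair:
moreover `Ext^i(A, B) = 0` for all `A ∈ 𝒜`, `B ∈ ℬ` and `i ≥ 1`. -/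
structure IsCompleteHereditaryCotorsionPair (C : Type u) [Category.{v} C] [Abelian C]
    [HasExt.{w} C] (𝒜 ℬ : Set C) extends IsCompleteCotorsionPair C 𝒜 ℬ : Prop where
  hereditary : ∀ A ∈ 𝒜, ∀ B ∈ ℬ, ∀ i : ℕ, 1 ≤ i → Subsingleton (Abelian.Ext.{w} A B i)

/-- `X` is a direct summand of a direct product of copies of `T`, i.e. `X ∈ Prod T`. -/
def IsProdMember {C : Type u} [Category.{v} C] (T X : C) : Prop :=
  ∃ (ι : Type v) (c : Fan fun _ : ι => T) (_ : IsLimit c) (s : X ⟶ c.pt) (r : c.pt ⟶ X),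
    s ≫ r = 𝟙 X

/-- An exact cochain complex is spliced from the short exact sequences
`0 → Zᵐ → Xᵐ → Zᵐ⁺¹ → 0`. -/
lemma shortExact_iCycles_toCycles {C : Type u} [Category.{v} C] [Abelian C]
    (X : CochainComplex C ℤ) (m : ℤ) (h : X.ExactAt (m + 1)) :
    (ShortComplex.mk (X.iCycles m) (X.toCycles m (m + 1)) (by
      rw [← cancel_mono (X.iCycles (m + 1))]; simp)).ShortExact where
  exact := by
    let φ : ShortComplex.mk (X.iCycles m) (X.toCycles m (m + 1)) (by
          rw [← cancel_mono (X.iCycles (m + 1))]; simp) ⟶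
        ShortComplex.mk (X.iCycles m) (X.d m (m + 1)) (X.iCycles_d _ _) :=
      { τ₁ := 𝟙 _, τ₂ := 𝟙 _, τ₃ := X.iCycles (m + 1) }
    have : Epi φ.τ₁ := inferInstanceAs (Epi (𝟙 _))
    have : IsIso φ.τ₂ := inferInstanceAs (IsIso (𝟙 _))
    have : Mono φ.τ₃ := inferInstanceAs (Mono (X.iCycles (m + 1)))
    rw [ShortComplex.exact_iff_of_epi_of_isIso_of_mono φ]
    exact ShortComplex.exact_of_f_is_kernel _ (X.cyclesIsKernel m (m + 1) (by simp))
  mono_f := inferInstanceAs (Mono (X.iCycles m))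
  epi_g := Preadditive.epi_of_isZero_cokernel' _
    (X.homologyIsCokernel m (m + 1) (by simp)) h.isZero_homology

/-- Dimension shifting: `Extⁱ(Zᵐ, Y)` embeds into `Extⁱ⁺ᵏ(Zᵐ⁺ᵏ, Y)` when the components of the
exact complex are `Ext`-acyclic with respect to `Y`. -/
lemma subsingleton_ext_cycles {C : Type u} [Category.{v} C] [Abelian C] [HasExt.{w} C]
    (X : CochainComplex C ℤ) (Y : C) (hX : ∀ m, X.ExactAt m)
    (hY : ∀ (m : ℤ) (i : ℕ), 1 ≤ i → Subsingleton (Abelian.Ext.{w} (X.X m) Y i))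
    (k i : ℕ) (hi : 1 ≤ i) (m : ℤ)
    (h : Subsingleton (Abelian.Ext.{w} (X.cycles (m + k)) Y (i + k))) :
    Subsingleton (Abelian.Ext.{w} (X.cycles m) Y i) := by
  induction k generalizing i m with
  | zero => simpa using h
  | succ k ih =>
    have hZ : Subsingleton (Abelian.Ext.{w} (X.cycles (m + 1)) Y (i + 1)) := by
      refine ih (i + 1) (by lia) (m + 1) ?_
      rwa [show m + 1 + (k : ℤ) = m + (k + 1 : ℕ) by push_cast; ring,
        show i + 1 + k = i + (k + 1) by ring]
    refine subsingleton_of_forall_eq 0 fun x => ?_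
    obtain ⟨y, rfl⟩ := Ext.contravariant_sequence_exact₁
      (shortExact_iCycles_toCycles X m (hX _)) Y x (add_comm 1 i) (hZ.elim _ _)
    rw [(hY m i hi).elim y 0, Ext.comp_zero]

/-- if `Cᵒ` is an `n`-cotilting right `R`-module and `𝒜` is the associated
cotilting class, then every acyclic complex with components in `𝒜` has all its cycles
in `𝒜` (`ex𝒜 = 𝒜~`).  Right `R`-modules are modules over `Rᵐᵒᵖ`. -/
theorem stmt6 (R : Type u) [Ring R] [HasExt.{w} (ModuleCat.{u} Rᵐᵒᵖ)]
    (n : ℕ) (Co : ModuleCat.{u} Rᵐᵒᵖ)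
    -- `Co` has injective dimension at most `n`:
    (hid : ∀ (N : ModuleCat.{u} Rᵐᵒᵖ) (i : ℕ), n < i → Subsingleton (Abelian.Ext.{w} N Co i))
    -- `Ext^i(Co^λ, Co) = 0` for every cardinal `λ` and every `i ≥ 1`:
    (hprods : ∀ (ι : Type u) (c : Fan fun _ : ι => Co), IsLimit c →
      ∀ i : ℕ, 1 ≤ i → Subsingleton (Abelian.Ext.{w} c.pt Co i))
    -- there is an exact sequence `0 → C_r → ⋯ → C_0 → W → 0` with `W` an injective
    -- cogenerator and each `C_j ∈ Prod Co`:
    (hres : ∃ (r : ℕ) (C' : Fin (r + 1) → ModuleCat.{u} Rᵐᵒᵖ)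
      (K : Fin (r + 2) → ModuleCat.{u} Rᵐᵒᵖ),
      (∀ j, IsProdMember Co (C' j)) ∧
      Injective (K 0) ∧ IsCoseparator (K 0) ∧ IsZero (K (Fin.last (r + 1))) ∧
      ∀ j : Fin (r + 1), IsShortExactSeq (K j.succ) (C' j) (K j.castSucc))
    -- `𝒜` is the associated `n`-cotilting class:
    (𝒜 : Set (ModuleCat.{u} Rᵐᵒᵖ))
    (hA : ∀ M : ModuleCat.{u} Rᵐᵒᵖ,
      M ∈ 𝒜 ↔ ∀ i : ℕ, 1 ≤ i → Subsingleton (Abelian.Ext.{w} M Co i))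
    (X : CochainComplex (ModuleCat.{u} Rᵐᵒᵖ) ℤ)
    (hac : ∀ m : ℤ, X.ExactAt m) (hcomp : ∀ m : ℤ, X.X m ∈ 𝒜) :
    ∀ m : ℤ, X.cycles m ∈ 𝒜 := by
  exact fun m => (hA _).2 fun i hi =>
    subsingleton_ext_cycles X Co hac (fun m => (hA _).1 (hcomp m)) n i hi m (hid _ _ (by lia))
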